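/- arXiv:2506.02816 — 9 statements merged into one kernel-verified Lean document; each statement's English description precedes it below -/
import Mathlib

section
/- Fix 1 ≤ k ≤ N and suppose λ ∈ ℝ is such that U_j(λ, γ) ≠ 0 for every j with 1 ≤ j ≤ k and every γ ∈ [0,1]^{j−1}. Then the matrices Z_1(λ), …, Z_k(λ) are well-defined and invertible (so Z_{k+1}(λ) is well-defined), and for every nonzero vector u ∈ ℝ^{n_k} there exist parameters γ_1, …, γ_k ∈ (0,1] such that (uᵀ Z_{k+1}(λ) u)/(uᵀ u) = U_{k+1}(λ, γ)/U_k(λ, γ). -/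
noncomputable section
open Matrix

/-- The parametric polynomials `U_k(x, γ)` (as real-valued functions), defined by
`U_0 = 1`, `U_1 = x - 1`, and
`U_{k+1}(x,γ) = ((-1)^{k+1} (1 - γ_k) + x) U_k(x,γ) - γ_k U_{k-1}(x,γ)` for `k ≥ 1`. -/
def Ufun (γ : ℕ → ℝ) : ℕ → ℝ → ℝ
  | 0, _ => 1
  | 1, x => x - 1
  | k+2, x => ((-1 : ℝ)^(k+2) * (1 - γ (k+1)) + x) * Ufun γ (k+1) x - γ (k+1) * Ufun γ k x

/-- The Schur complements `S_0 = A_0`, `S_{k+1} = A_{k+1} + B_k S_k⁻¹ B_kᵀ` (here `B k`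
is the block coupling levels `k` and `k+1`, i.e. the paper's `B_{k+1}`). -/
def schurComp (n : ℕ → ℕ)
    (A : ∀ k : ℕ, Matrix (Fin (n k)) (Fin (n k)) ℝ)
    (B : ∀ k : ℕ, Matrix (Fin (n (k + 1))) (Fin (n k)) ℝ) :
    ∀ k : ℕ, Matrix (Fin (n k)) (Fin (n k)) ℝ
  | 0 => A 0
  | k+1 => A (k + 1) + B k * (schurComp n A B k)⁻¹ * (B k)ᵀ

/-- `R_{k+1} = S_{k+1}^{-1/2} B_{k+1} S_k^{-1/2}`; here `Ssq k` is the symmetric positive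
definite square root `S_k^{1/2}` and `Rmat … k` is the paper's `R_{k+1}`. -/
def Rmat (n : ℕ → ℕ)
    (B : ∀ k : ℕ, Matrix (Fin (n (k + 1))) (Fin (n k)) ℝ)
    (Ssq : ∀ k : ℕ, Matrix (Fin (n k)) (Fin (n k)) ℝ) (k : ℕ) :
    Matrix (Fin (n (k + 1))) (Fin (n k)) ℝ :=
  (Ssq (k + 1))⁻¹ * B k * (Ssq k)⁻¹

/-- The matrix-valued functions `Z_k(λ)`; here `Zmat … j lam` is the paper's `Z_{j+1}(λ)`,
a matrix of size `n_j`: `Z_1(λ) = (λ-1) I` and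
`Z_{k+1}(λ) = -R_k Z_k(λ)⁻¹ R_kᵀ + λ I + (-1)^{k+1}(I - R_k R_kᵀ)`. -/
def Zmat (n : ℕ → ℕ)
    (B : ∀ k : ℕ, Matrix (Fin (n (k + 1))) (Fin (n k)) ℝ)
    (Ssq : ∀ k : ℕ, Matrix (Fin (n k)) (Fin (n k)) ℝ) :
    ∀ j : ℕ, ℝ → Matrix (Fin (n j)) (Fin (n j)) ℝ
  | 0, lam => (lam - 1) • (1 : Matrix (Fin (n 0)) (Fin (n 0)) ℝ)
  | j+1, lam =>
      -(Rmat n B Ssq j * (Zmat n B Ssq j lam)⁻¹ * (Rmat n B Ssq j)ᵀ) +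
        lam • (1 : Matrix (Fin (n (j + 1))) (Fin (n (j + 1))) ℝ) +
        ((-1 : ℝ)^(j + 2)) • ((1 : Matrix (Fin (n (j + 1))) (Fin (n (j + 1))) ℝ) -
          Rmat n B Ssq j * (Rmat n B Ssq j)ᵀ)

lemma Ufun_congr {γ δ : ℕ → ℝ} (x : ℝ) :
    ∀ m : ℕ, (∀ t, 1 ≤ t → t < m → γ t = δ t) → Ufun γ m x = Ufun δ m x
  | 0, _ => rfl
  | 1, _ => rfl
  | m + 2, h => by
    rw [Ufun, Ufun, Ufun_congr x (m + 1) fun t ht htm => h t ht (by omega),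
      Ufun_congr x m fun t ht htm => h t ht (by omega), h (m + 1) (by omega) (by omega)]

lemma continuous_Ufun (x : ℝ) : ∀ m : ℕ, Continuous fun γ : ℕ → ℝ => Ufun γ m x
  | 0 => by simpa only [Ufun] using continuous_const
  | 1 => by simpa only [Ufun] using continuous_const
  | m + 2 => by
    have h1 := continuous_Ufun x (m + 1)
    have h0 := continuous_Ufun x m
    simp only [Ufun]
    fun_prop

/-- The parameters with `γ_1, …, γ_m ∈ (0,1]`. -/
def paramBox (m : ℕ) : Set (ℕ → ℝ) :=
  {γ | ∀ t, 1 ≤ t → t ≤ m → γ t ∈ Set.Ioc (0 : ℝ) 1}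

lemma convex_paramBox (m : ℕ) : Convex ℝ (paramBox m) := by
  intro γ hγ δ hδ a b ha hb hab t h1 hm
  exact convex_Ioc 0 1 (hγ t h1 hm) (hδ t h1 hm) ha hb hab

lemma convex_image_Ufun_div (m : ℕ) (x : ℝ) (h : ∀ γ ∈ paramBox m, Ufun γ (m + 1) x ≠ 0) :
    Convex ℝ ((fun γ => Ufun γ m x / Ufun γ (m + 1) x) '' paramBox m) :=
  (((convex_paramBox m).isPreconnected.image _
    ((continuous_Ufun x m).continuousOn.div (continuous_Ufun x (m + 1)).continuousOn
      h)).ordConnected).convex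

lemma dotProduct_self_pos {ι : Type*} [Fintype ι] {v : ι → ℝ} (hv : v ≠ 0) : 0 < v ⬝ᵥ v :=
  (Finset.sum_nonneg fun i _ => mul_self_nonneg (v i)).lt_of_ne'
    (dotProduct_self_eq_zero.not.mpr hv)

/-- The Rayleigh quotients of a symmetric matrix lie in every convex set containing its
eigenvalues. -/
lemma Matrix.IsHermitian.exists_rayleigh_mem {ι : Type*} [Fintype ι] [DecidableEq ι]
    {M : Matrix ι ι ℝ} (hM : M.IsHermitian) {s : Set ℝ} (hs : Convex ℝ s)
    (hev : ∀ (v : ι → ℝ) (μ : ℝ), v ≠ 0 → M *ᵥ v = μ • v → μ ∈ s)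
    {w : ι → ℝ} (hw : w ≠ 0) : ∃ r ∈ s, w ⬝ᵥ M *ᵥ w = r * (w ⬝ᵥ w) := by
  set c : ι → ℝ := fun i => (hM.eigenvectorBasis i).ofLp ⬝ᵥ w with hc
  have hinner (x y : ι → ℝ) : x ⬝ᵥ y =
      ∑ i, ((hM.eigenvectorBasis i).ofLp ⬝ᵥ x) * ((hM.eigenvectorBasis i).ofLp ⬝ᵥ y) := by
    have := hM.eigenvectorBasis.sum_inner_mul_inner (WithLp.toLp 2 x) (WithLp.toLp 2 y)
    simp only [EuclideanSpace.inner_eq_star_dotProduct, star_trivial] at this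
    rw [dotProduct_comm x y, ← this]
    exact Finset.sum_congr rfl fun i _ => by rw [dotProduct_comm y]
  have hT : Mᵀ = M := by simpa [Matrix.IsHermitian] using hM
  have hcM (i : ι) : (hM.eigenvectorBasis i).ofLp ⬝ᵥ M *ᵥ w = hM.eigenvalues i * c i := by
    rw [dotProduct_mulVec, ← mulVec_transpose, hT, hM.mulVec_eigenvectorBasis,
      smul_dotProduct, smul_eq_mul]
  have hpos : 0 < w ⬝ᵥ w := dotProduct_self_pos hw
  refine ⟨∑ i, (c i * c i / (w ⬝ᵥ w)) • hM.eigenvalues i, hs.sum_mem ?_ ?_ ?_, ?_⟩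
  · exact fun i _ => div_nonneg (mul_self_nonneg _) hpos.le
  · rw [← Finset.sum_div, div_eq_one_iff_eq hpos.ne', hinner w w]
  · refine fun i _ => hev (hM.eigenvectorBasis i).ofLp _ (fun h => ?_)
      (hM.mulVec_eigenvectorBasis i)
    exact hM.eigenvectorBasis.orthonormal.ne_zero i (by ext j; exact congrFun h j)
  · rw [hinner w, Finset.sum_mul]
    refine Finset.sum_congr rfl fun i _ => ?_
    rw [hcM, smul_eq_mul]
    change c i * _ = _
    field_simp

lemma Matrix.PosDef.transpose_eq_self {ι : Type*} {S : Matrix ι ι ℝ} (hS : S.PosDef) :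
    Sᵀ = S := by
  simpa [Matrix.IsHermitian] using hS.isHermitian

lemma Rmat_transpose_mulVec_ne_zero {n : ℕ → ℕ}
    {B : ∀ k : ℕ, Matrix (Fin (n (k + 1))) (Fin (n k)) ℝ}
    {Ssq : ∀ k : ℕ, Matrix (Fin (n k)) (Fin (n k)) ℝ} {m : ℕ}
    (hB : (B m).rank = n (m + 1)) (h0 : (Ssq m).PosDef) (h1 : (Ssq (m + 1)).PosDef)
    {u : Fin (n (m + 1)) → ℝ} (hu : u ≠ 0) : (Rmat n B Ssq m)ᵀ *ᵥ u ≠ 0 := by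
  have hBinj : Function.Injective (B m)ᵀ.mulVec := by
    rw [mulVec_injective_iff, col_transpose, linearIndependent_iff_card_eq_finrank_span,
      Set.finrank, ← rank_eq_finrank_span_row, hB, Fintype.card_fin]
  have h0' : Function.Injective (Ssq m)⁻¹ᵀ.mulVec :=
    mulVec_injective_iff_isUnit.mpr h0.inv.transpose.isUnit
  have h1' : Function.Injective (Ssq (m + 1))⁻¹ᵀ.mulVec :=
    mulVec_injective_iff_isUnit.mpr h1.inv.transpose.isUnit
  have hinj : Function.Injective (Rmat n B Ssq m)ᵀ.mulVec := by
    have := h0'.comp (hBinj.comp h1')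
    convert this using 1
    ext v : 1
    simp [Rmat, transpose_mul, mulVec_mulVec, Function.comp]
  exact fun h => hu (hinj (by rw [h, mulVec_zero]))

lemma Rmat_transpose_mulVec_dotProduct_le {n : ℕ → ℕ}
    {A : ∀ k : ℕ, Matrix (Fin (n k)) (Fin (n k)) ℝ}
    {B : ∀ k : ℕ, Matrix (Fin (n (k + 1))) (Fin (n k)) ℝ}
    {Ssq : ∀ k : ℕ, Matrix (Fin (n k)) (Fin (n k)) ℝ} {m : ℕ}
    (hA : (A (m + 1)).PosSemidef) (h0 : (Ssq m).PosDef) (h1 : (Ssq (m + 1)).PosDef)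
    (hS0 : Ssq m * Ssq m = schurComp n A B m)
    (hS1 : Ssq (m + 1) * Ssq (m + 1) = schurComp n A B (m + 1))
    (u : Fin (n (m + 1)) → ℝ) :
    ((Rmat n B Ssq m)ᵀ *ᵥ u) ⬝ᵥ ((Rmat n B Ssq m)ᵀ *ᵥ u) ≤ u ⬝ᵥ u := by
  have t0 := h0.inv.transpose_eq_self
  have t1 := h1.inv.transpose_eq_self
  have hd : IsUnit (Ssq (m + 1)).det := (isUnit_iff_isUnit_det _).mp h1.isUnit
  have hRR : Rmat n B Ssq m * (Rmat n B Ssq m)ᵀ =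
      1 - (Ssq (m + 1))⁻¹ * A (m + 1) * (Ssq (m + 1))⁻¹ := by
    have hBS : B m * ((Ssq m)⁻¹ * (Ssq m)⁻¹) * (B m)ᵀ =
        Ssq (m + 1) * Ssq (m + 1) - A (m + 1) := by
      rw [hS1, schurComp, ← hS0, Matrix.mul_inv_rev, add_sub_cancel_left]
    calc Rmat n B Ssq m * (Rmat n B Ssq m)ᵀ
        = (Ssq (m + 1))⁻¹ * (B m * ((Ssq m)⁻¹ * (Ssq m)⁻¹) * (B m)ᵀ) * (Ssq (m + 1))⁻¹ := by
          simp only [Rmat, transpose_mul, t0, t1, Matrix.mul_assoc]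
      _ = _ := by
          rw [hBS, Matrix.mul_sub, Matrix.sub_mul, ← Matrix.mul_assoc, nonsing_inv_mul _ hd,
            Matrix.one_mul, mul_nonsing_inv _ hd]
  have hAq := hA.dotProduct_mulVec_nonneg ((Ssq (m + 1))⁻¹ *ᵥ u)
  have hq : u ⬝ᵥ ((Ssq (m + 1))⁻¹ * A (m + 1) * (Ssq (m + 1))⁻¹) *ᵥ u =
      ((Ssq (m + 1))⁻¹ *ᵥ u) ⬝ᵥ A (m + 1) *ᵥ ((Ssq (m + 1))⁻¹ *ᵥ u) := by
    rw [← mulVec_mulVec, ← mulVec_mulVec, dotProduct_mulVec, ← mulVec_transpose, t1]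
  rw [mulVec_transpose, ← dotProduct_mulVec, ← mulVec_transpose, mulVec_mulVec, hRR, sub_mulVec,
    one_mulVec, dotProduct_sub, hq]
  simp only [star_trivial] at hAq
  linarith

lemma Zmat_isHermitian (n : ℕ → ℕ) (B : ∀ k : ℕ, Matrix (Fin (n (k + 1))) (Fin (n k)) ℝ)
    (Ssq : ∀ k : ℕ, Matrix (Fin (n k)) (Fin (n k)) ℝ) (lam : ℝ) :
    ∀ j, (Zmat n B Ssq j lam).IsHermitian
  | 0 => by simp [Zmat, Matrix.IsHermitian]
  | j + 1 => by
    have ih : (Zmat n B Ssq j lam)ᵀ = Zmat n B Ssq j lam := by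
      simpa [Matrix.IsHermitian] using Zmat_isHermitian n B Ssq lam j
    simp [Zmat, Matrix.IsHermitian, transpose_mul, transpose_nonsing_inv, ih, Matrix.mul_assoc]

/-- The Rayleigh quotients of `Z` are values of `U_{m+1}(λ, ·) / U_m(λ, ·)`. -/
def RayleighRepr {ι : Type*} [Fintype ι] (Z : Matrix ι ι ℝ) (m : ℕ) (lam : ℝ) : Prop :=
  ∀ u : ι → ℝ, u ≠ 0 → ∃ γ ∈ paramBox m,
    u ⬝ᵥ Z *ᵥ u = Ufun γ (m + 1) lam / Ufun γ m lam * (u ⬝ᵥ u)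

lemma RayleighRepr.isUnit {ι : Type*} [Fintype ι] [DecidableEq ι] {Z : Matrix ι ι ℝ} {m : ℕ}
    {lam : ℝ} (hZ : RayleighRepr Z m lam) (h0 : ∀ γ ∈ paramBox m, Ufun γ m lam ≠ 0)
    (h1 : ∀ γ ∈ paramBox m, Ufun γ (m + 1) lam ≠ 0) : IsUnit Z := by
  rw [← mulVec_injective_iff_isUnit]
  refine (injective_iff_map_eq_zero Z.mulVecLin).mpr fun v hv => ?_
  by_contra hv0
  obtain ⟨γ, hγ, h⟩ := hZ v hv0
  rw [mulVecLin_apply] at hv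
  rw [hv, dotProduct_zero] at h
  exact mul_ne_zero (div_ne_zero (h1 γ hγ) (h0 γ hγ)) (dotProduct_self_pos hv0).ne' h.symm

/-- The Rayleigh quotients of the inverse are values of the reciprocal quotient: this set of
values is an interval which contains all eigenvalues of `Z⁻¹`. -/
lemma RayleighRepr.inv {ι : Type*} [Fintype ι] [DecidableEq ι] {Z : Matrix ι ι ℝ} {m : ℕ}
    {lam : ℝ} (hZ : RayleighRepr Z m lam) (hH : Z.IsHermitian)
    (h0 : ∀ γ ∈ paramBox m, Ufun γ m lam ≠ 0)
    (h1 : ∀ γ ∈ paramBox m, Ufun γ (m + 1) lam ≠ 0) {w : ι → ℝ} (hw : w ≠ 0) :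
    ∃ γ ∈ paramBox m, w ⬝ᵥ Z⁻¹ *ᵥ w = Ufun γ m lam / Ufun γ (m + 1) lam * (w ⬝ᵥ w) := by
  have hd : IsUnit Z.det := (isUnit_iff_isUnit_det _).mp (hZ.isUnit h0 h1)
  have hmem (v : ι → ℝ) (μ : ℝ) (hv : v ≠ 0) (hμ : Z⁻¹ *ᵥ v = μ • v) :
      μ ∈ (fun γ => Ufun γ m lam / Ufun γ (m + 1) lam) '' paramBox m := by
    obtain ⟨γ, hγ, h⟩ := hZ v hv
    refine ⟨γ, hγ, ?_⟩
    have hv' : v = μ • Z *ᵥ v := by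
      rw [← mulVec_smul, ← hμ, mulVec_mulVec, mul_nonsing_inv _ hd, one_mulVec]
    have hvv := congrArg (v ⬝ᵥ ·) hv'
    simp only [dotProduct_smul, h, smul_eq_mul] at hvv
    have := h0 γ hγ
    have := h1 γ hγ
    have := (dotProduct_self_pos hv).ne'
    field_simp at hvv ⊢
    linarith
  obtain ⟨_, ⟨γ, hγ, rfl⟩, h⟩ :=
    hH.inv.exists_rayleigh_mem (convex_image_Ufun_div m lam h1) hmem hw
  exact ⟨γ, hγ, h⟩

/-- if `λ` is not a zero of any `U_j(·,γ)` for `1 ≤ j ≤ k` and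
`γ ∈ [0,1]^{j-1}`, then `Z_1(λ), …, Z_k(λ)` are invertible (so `Z_{k+1}(λ)` is
well-defined), and for every nonzero `u ∈ ℝ^{n_k}` there are `γ₁, …, γ_k ∈ (0,1]` with
`uᵀ Z_{k+1}(λ) u / uᵀu = U_{k+1}(λ,γ) / U_k(λ,γ)`. -/
theorem stmt10 (N : ℕ) (hN : 1 ≤ N) (n : ℕ → ℕ) (hnN : 1 ≤ n N)
    (hmono : ∀ k < N, n (k + 1) ≤ n k)
    (A : ∀ k : ℕ, Matrix (Fin (n k)) (Fin (n k)) ℝ)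
    (B : ∀ k : ℕ, Matrix (Fin (n (k + 1))) (Fin (n k)) ℝ)
    (hA0 : (A 0).PosDef)
    (hA : ∀ k, 1 ≤ k → k ≤ N → (A k).PosSemidef)
    (hB : ∀ k < N, (B k).rank = n (k + 1))
    (Ssq : ∀ k : ℕ, Matrix (Fin (n k)) (Fin (n k)) ℝ)
    (hSsq : ∀ k ≤ N, (Ssq k).PosDef ∧ Ssq k * Ssq k = schurComp n A B k)
    (k : ℕ) (hk1 : 1 ≤ k) (hkN : k ≤ N) (lam : ℝ)
    (hlam : ∀ j, 1 ≤ j → j ≤ k → ∀ γ : ℕ → ℝ,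
      (∀ t, 1 ≤ t → t ≤ j - 1 → γ t ∈ Set.Icc (0 : ℝ) 1) → Ufun γ j lam ≠ 0) :
    (∀ j < k, IsUnit (Zmat n B Ssq j lam)) ∧
    ∀ u : Fin (n k) → ℝ, u ≠ 0 → ∃ γ : ℕ → ℝ,
      (∀ t, 1 ≤ t → t ≤ k → γ t ∈ Set.Ioc (0 : ℝ) 1) ∧
      (u ⬝ᵥ (Zmat n B Ssq k lam).mulVec u) / (u ⬝ᵥ u) =
        Ufun γ (k + 1) lam / Ufun γ k lam := by
  have hne (m : ℕ) (hm : m ≤ k) (p : ℕ) (hp : m ≤ p + 1) :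
      ∀ γ ∈ paramBox p, Ufun γ m lam ≠ 0 := by
    rintro γ hγ
    rcases Nat.eq_zero_or_pos m with rfl | hpos
    · simp [Ufun]
    · exact hlam m hpos hm γ fun t h1 ht => Set.Ioc_subset_Icc_self (hγ t h1 (by omega))
  have key : ∀ m ≤ k, RayleighRepr (Zmat n B Ssq m lam) m lam := by
    intro m
    induction m with
    | zero =>
      intro _ u _
      refine ⟨fun _ => 1, fun t _ _ => by simp, ?_⟩
      simp [Zmat, Ufun, smul_mulVec]
    | succ m ih =>
      intro hm u hu
      obtain ⟨p0, s0⟩ := hSsq m (by omega)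
      obtain ⟨p1, s1⟩ := hSsq (m + 1) (by omega)
      set w := (Rmat n B Ssq m)ᵀ *ᵥ u with hwdef
      have hw : w ≠ 0 := Rmat_transpose_mulVec_ne_zero (hB m (by omega)) p0 p1 hu
      have hle : w ⬝ᵥ w ≤ u ⬝ᵥ u := Rmat_transpose_mulVec_dotProduct_le
        (hA (m + 1) (by omega) (by omega)) p0 p1 s0 s1 u
      have hupos := dotProduct_self_pos hu
      obtain ⟨γ, hγ, h⟩ := (ih (by omega)).inv (Zmat_isHermitian n B Ssq lam m)
        (hne m (by omega) m (by omega)) (hne (m + 1) hm m le_rfl) hw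
      have hU := hne (m + 1) hm m le_rfl γ hγ
      set g := w ⬝ᵥ w / (u ⬝ᵥ u) with hg
      have hwg : w ⬝ᵥ w = g * (u ⬝ᵥ u) := by rw [hg]; field_simp
      have hquad (M : Matrix (Fin (n m)) (Fin (n m)) ℝ) :
          u ⬝ᵥ (Rmat n B Ssq m * M * (Rmat n B Ssq m)ᵀ) *ᵥ u = w ⬝ᵥ M *ᵥ w := by
        rw [← mulVec_mulVec, ← mulVec_mulVec, dotProduct_mulVec, ← mulVec_transpose]
      have hquad1 : u ⬝ᵥ (Rmat n B Ssq m * (Rmat n B Ssq m)ᵀ) *ᵥ u = w ⬝ᵥ w := by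
        simpa using hquad 1
      refine ⟨Function.update γ (m + 1) g, fun t h1 ht => ?_, ?_⟩
      · rcases eq_or_ne t (m + 1) with rfl | hne'
        · rw [Function.update_self]
          exact ⟨div_pos (dotProduct_self_pos hw) hupos, (div_le_one hupos).mpr hle⟩
        · rw [Function.update_of_ne hne']
          exact hγ t h1 (by omega)
      · have hcongr (p : ℕ) (hp : p ≤ m + 1) :
            Ufun (Function.update γ (m + 1) g) p lam = Ufun γ p lam :=
          Ufun_congr lam p fun t _ ht => Function.update_of_ne (by omega) _ _
        rw [Ufun, hcongr (m + 1) le_rfl, hcongr m (by omega), Function.update_self, Zmat]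
        simp only [add_mulVec, sub_mulVec, neg_mulVec, smul_mulVec, one_mulVec, dotProduct_add,
          dotProduct_sub, dotProduct_neg, dotProduct_smul, smul_eq_mul, hquad, hquad1, h, hwg]
        field_simp
        ring
  refine ⟨fun j hj => (key j hj.le).isUnit (hne j hj.le j (by omega)) (hne (j + 1) hj j le_rfl),
    fun u hu => ?_⟩
  obtain ⟨γ, hγ, h⟩ := key k le_rfl u hu
  exact ⟨γ, hγ, by rw [h, mul_div_cancel_right₀ _ (dotProduct_self_pos hu).ne']⟩
end
end

section
/- For every integer k ≥ 0 and all parameters γ_1, …, γ_k ∈ (0,1], the polynomial U_{k+1}(x, γ) is a monic real polynomial of degree k+1 having k+1 distinct real roots. -/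
noncomputable section
open Polynomial

/-- The parametric polynomials `U_k(x, γ)` as actual real polynomials, defined by
`U_0 = 1`, `U_1 = X - 1`, and
`U_{k+1} = (C((-1)^{k+1} (1 - γ_k)) + X) U_k - C(γ_k) U_{k-1}` for `k ≥ 1`. -/
def Upoly (γ : ℕ → ℝ) : ℕ → Polynomial ℝ
  | 0 => 1
  | 1 => X - C 1
  | k+2 => (C ((-1 : ℝ)^(k+2) * (1 - γ (k+1))) + X) * Upoly γ (k+1) - C (γ (k+1)) * Upoly γ k

/-- At a non-real point, `U_{k+1} / U_k` has imaginary part of the same sign as the point. -/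
theorem Upoly_im_pos (γ : ℕ → ℝ) (k : ℕ) (hγ : ∀ t, 1 ≤ t → t ≤ k → 0 < γ t)
    {z : ℂ} (hz : z.im ≠ 0) :
    0 < (aeval z (Upoly γ (k + 1)) * starRingEnd ℂ (aeval z (Upoly γ k))).im * z.im := by
  induction k with
  | zero => simpa [Upoly] using mul_self_pos.2 hz
  | succ k ih =>
    have h := mul_pos (hγ (k + 1) (by lia) le_rfl) (ih fun t h1 h2 => hγ t h1 (by lia))
    have hs := mul_nonneg (mul_self_nonneg z.im)
      (Complex.normSq_nonneg (aeval z (Upoly γ (k + 1))))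
    have hc : ∀ r : ℝ, aeval z (C r : ℝ[X]) = (r : ℂ) := fun r => aeval_C z r
    rw [Upoly]
    generalize (-1 : ℝ) ^ (k + 2) * (1 - γ (k + 1)) = a
    simp only [map_sub, map_mul, map_add, hc, aeval_X]
    generalize aeval z (Upoly γ (k + 1)) = u at *
    generalize aeval z (Upoly γ k) = v at *
    simp [Complex.normSq_apply] at h hs ⊢
    linarith

/-- The Wronskian of consecutive polynomials `U_k` is positive on the real line. -/
theorem Upoly_wronskian_pos (γ : ℕ → ℝ) (k : ℕ) (hγ : ∀ t, 1 ≤ t → t ≤ k → 0 < γ t) (x : ℝ) :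
    0 < (derivative (Upoly γ (k + 1))).eval x * (Upoly γ k).eval x
      - (Upoly γ (k + 1)).eval x * (derivative (Upoly γ k)).eval x := by
  induction k with
  | zero => simp [Upoly]
  | succ k ih =>
    have h := mul_pos (hγ (k + 1) (by lia) le_rfl) (ih fun t h1 h2 => hγ t h1 (by lia))
    have hs := mul_self_nonneg ((Upoly γ (k + 1)).eval x)
    rw [Upoly]
    generalize (-1 : ℝ) ^ (k + 2) * (1 - γ (k + 1)) = a at *
    simp only [derivative_sub, derivative_mul, derivative_add, derivative_C, derivative_X,
      eval_sub, eval_mul, eval_add, eval_C, eval_X, eval_zero, eval_one]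
    linarith

theorem Upoly_monic_natDegree (γ : ℕ → ℝ) (k : ℕ) :
    (Upoly γ k).Monic ∧ (Upoly γ k).natDegree = k := by
  induction k using Nat.strong_induction_on with
  | _ k ih =>
    match k, ih with
    | 0, _ => simp [Upoly]
    | 1, _ => exact ⟨monic_X_sub_C 1, natDegree_X_sub_C 1⟩
    | k + 2, ih =>
      obtain ⟨hm, hd⟩ := ih (k + 1) (by lia)
      have hd' := (ih k (by lia)).2
      rw [Upoly]
      generalize (-1 : ℝ) ^ (k + 2) * (1 - γ (k + 1)) = a
      have hm2 : ((C a + X) * Upoly γ (k + 1)).Monic := by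
        rw [add_comm]; exact (monic_X_add_C a).mul hm
      have hd2 : ((C a + X) * Upoly γ (k + 1)).natDegree = k + 2 := by
        rw [add_comm, (monic_X_add_C a).natDegree_mul hm, natDegree_X_add_C, hd]
        lia
      have hlt : (C (γ (k + 1)) * Upoly γ k).natDegree < ((C a + X) * Upoly γ (k + 1)).natDegree :=
        lt_of_le_of_lt (natDegree_C_mul_le _ _) (by lia)
      exact ⟨hm2.sub_of_left (degree_lt_degree hlt), by
        rw [natDegree_sub_eq_left_of_natDegree_lt hlt, hd2]⟩

/-- A real polynomial all of whose complex roots are real splits over `ℝ`. -/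
theorem splits_of_aeval_ne_zero {p : ℝ[X]} (hp : ∀ z : ℂ, z.im ≠ 0 → aeval z p ≠ 0) :
    p.Splits := by
  refine (IsAlgClosed.splits (p.map (algebraMap ℝ ℂ))).of_splits_map _ fun z hz => ?_
  by_cases him : z.im = 0
  · exact ⟨z.re, Complex.ext rfl him.symm⟩
  · exact absurd ((mem_aroots'.1 hz).2) (hp z him)

/-- for every `k ≥ 0` and parameters `γ₁, …, γ_k ∈ (0,1]`, the polynomial
`U_{k+1}(·, γ)` is a monic real polynomial of degree `k+1` having `k+1` distinct real
roots. -/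
theorem stmt11 (k : ℕ) (γ : ℕ → ℝ)
    (hγ : ∀ t, 1 ≤ t → t ≤ k → γ t ∈ Set.Ioc (0 : ℝ) 1) :
    (Upoly γ (k + 1)).Monic ∧ (Upoly γ (k + 1)).natDegree = k + 1 ∧
    (Upoly γ (k + 1)).roots.toFinset.card = k + 1 := by
  obtain ⟨hm, hd⟩ := Upoly_monic_natDegree γ (k + 1)
  have hpos : ∀ t, 1 ≤ t → t ≤ k → 0 < γ t := fun t h1 h2 => (hγ t h1 h2).1
  have hsplits : (Upoly γ (k + 1)).Splits := splits_of_aeval_ne_zero fun z hz h0 => by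
    simpa [h0] using Upoly_im_pos γ k hpos hz
  have hnodup : (Upoly γ (k + 1)).roots.Nodup := by
    refine Multiset.nodup_iff_count_le_one.2 fun x => ?_
    by_contra! hlt
    rw [count_roots, one_lt_rootMultiplicity_iff_isRoot hm.ne_zero] at hlt
    have hw := Upoly_wronskian_pos γ k hpos x
    rw [hlt.1.eq_zero, hlt.2.eq_zero] at hw
    simp at hw
  refine ⟨hm, hd, ?_⟩
  rw [Multiset.toFinset_card_of_nodup hnodup, ← hsplits.natDegree_eq_card_roots, hd]
end
end

section
/- For k ≥ 0 define a_{k+1}(x, γ) = U_k(x, γ)·U'_{k+1}(x, γ) − U'_k(x, γ)·U_{k+1}(x, γ), where the prime denotes the derivative with respect to x. Then a_1(x, γ) = 1 identically, a_{k+1}(x, γ) = U_k(x, γ)² + γ_k·a_k(x, γ) for every k ≥ 1, a_{k+1} is a monic polynomial of degree 2k in x, and if γ_1, …, γ_k ∈ (0,1] then a_{k+1}(λ, γ) > 0 for every real λ. -/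
noncomputable section
open Polynomial

/-- `a_{k+1}(x, γ) = U_k(x,γ) U'_{k+1}(x,γ) - U'_k(x,γ) U_{k+1}(x,γ)` (here `apoly γ k`
denotes `a_{k+1}`). -/
def apoly (γ : ℕ → ℝ) (k : ℕ) : Polynomial ℝ :=
  Upoly γ k * derivative (Upoly γ (k + 1)) - derivative (Upoly γ k) * Upoly γ (k + 1)

theorem Polynomial.Monic.add_C_mul_of_natDegree_lt {R : Type*} [CommRing R] [Nontrivial R]
    {p q : R[X]} (c : R) (hp : p.Monic) (h : q.natDegree < p.natDegree) :
    (p + C c * q).Monic ∧ (p + C c * q).natDegree = p.natDegree := by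
  have hlt : (C c * q).natDegree < p.natDegree := (natDegree_C_mul_le c q).trans_lt h
  exact ⟨hp.add_of_left (degree_lt_degree hlt), natDegree_add_eq_left_of_natDegree_lt hlt⟩

theorem apoly_zero (γ : ℕ → ℝ) : apoly γ 0 = 1 := by
  simp [apoly, Upoly]

theorem apoly_succ (γ : ℕ → ℝ) (k : ℕ) :
    apoly γ (k + 1) = Upoly γ (k + 1) ^ 2 + C (γ (k + 1)) * apoly γ k := by
  simp only [apoly, Upoly, derivative_sub, derivative_mul, derivative_add, derivative_C,
    derivative_X]
  ring

theorem apoly_monic_natDegree (γ : ℕ → ℝ) (k : ℕ) :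
    (apoly γ k).Monic ∧ (apoly γ k).natDegree = 2 * k := by
  induction k with
  | zero => simp [apoly_zero]
  | succ k ih =>
    obtain ⟨hU, hUdeg⟩ := Upoly_monic_natDegree γ (k + 1)
    have hdeg : (Upoly γ (k + 1) ^ 2).natDegree = 2 * (k + 1) := by
      rw [hU.natDegree_pow, hUdeg]
    have key := (hU.pow 2).add_C_mul_of_natDegree_lt (q := apoly γ k) (γ (k + 1))
      (by rw [hdeg, ih.2]; omega)
    rwa [hdeg, ← apoly_succ] at key

theorem apoly_eval_pos (γ : ℕ → ℝ) (k : ℕ) (hγ : ∀ t, 1 ≤ t → t ≤ k → 0 < γ t) (x : ℝ) :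
    0 < (apoly γ k).eval x := by
  induction k with
  | zero => simp [apoly_zero]
  | succ k ih =>
    have hpos := ih fun t h₁ h₂ => hγ t h₁ (h₂.trans k.le_succ)
    have hk := hγ (k + 1) k.succ_pos le_rfl
    simp only [apoly_succ, eval_add, eval_pow, eval_mul, eval_C]
    positivity

/-- `a_1 = 1`, `a_{k+1} = U_k² + γ_k a_k` for `k ≥ 1`, `a_{k+1}` is monic of
degree `2k`, and if `γ₁, …, γ_k ∈ (0,1]` then `a_{k+1}(λ,γ) > 0` for every real `λ`. -/
theorem stmt12 (γ : ℕ → ℝ) :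
    apoly γ 0 = 1 ∧
    (∀ k, 1 ≤ k → apoly γ k = (Upoly γ k)^2 + C (γ k) * apoly γ (k - 1)) ∧
    (∀ k, (apoly γ k).Monic ∧ (apoly γ k).natDegree = 2 * k) ∧
    (∀ k, (∀ t, 1 ≤ t → t ≤ k → γ t ∈ Set.Ioc (0 : ℝ) 1) →
      ∀ lam : ℝ, 0 < (apoly γ k).eval lam) := by
  refine ⟨apoly_zero γ, fun k hk => ?_, apoly_monic_natDegree γ, fun k hγ lam =>
    apoly_eval_pos γ k (fun t h₁ h₂ => (hγ t h₁ h₂).1) lam⟩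
  obtain ⟨j, rfl⟩ := Nat.exists_eq_add_of_le' hk
  exact apoly_succ γ j
end
end

section
/- Let k ≥ 1 and γ_1, …, γ_k ∈ (0,1]. Then for every real root ξ of U_k(·, γ) one has U'_k(ξ, γ)·U_{k+1}(ξ, γ) < 0 (derivative with respect to x); consequently the values of U_{k+1}(·, γ) at the ordered roots of U_k(·, γ) alternate in sign, and the roots of U_k(·, γ) and U_{k+1}(·, γ) strictly interlace. -/
noncomputable section
open Polynomial

/-- A polynomial taking values of opposite sign at `a < b` has a root strictly between them. -/
theorem exists_eval_eq_zero_of_mul_neg (p : Polynomial ℝ) {a b : ℝ} (hab : a < b)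
    (h : p.eval a * p.eval b < 0) : ∃ c, a < c ∧ c < b ∧ p.eval c = 0 := by
  have hc : ContinuousOn (fun x => p.eval x) (Set.Icc a b) := p.continuous.continuousOn
  rcases mul_neg_iff.mp h with ⟨ha, hb⟩ | ⟨ha, hb⟩
  · obtain ⟨c, hc, h0⟩ := intermediate_value_Ioo' hab.le hc ⟨hb, ha⟩
    exact ⟨c, hc.1, hc.2, h0⟩
  · obtain ⟨c, hc, h0⟩ := intermediate_value_Ioo hab.le hc ⟨ha, hb⟩
    exact ⟨c, hc.1, hc.2, h0⟩

/-- If the derivatives of `p` at two roots have the same strict sign, then `p` has another root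
strictly between them. -/
theorem exists_eval_eq_zero_of_derivative_mul_pos (p : Polynomial ℝ) {a b : ℝ} (hab : a < b)
    (ha : p.eval a = 0) (hb : p.eval b = 0)
    (h : 0 < (derivative p).eval a * (derivative p).eval b) :
    ∃ c, a < c ∧ c < b ∧ p.eval c = 0 := by
  obtain ⟨q, rfl⟩ := dvd_iff_isRoot.mpr ha
  have hq : q.eval b = 0 := by
    simpa [sub_ne_zero.mpr hab.ne'] using hb
  obtain ⟨r, rfl⟩ := dvd_iff_isRoot.mpr hq
  have hr : r.eval a * r.eval b < 0 := by
    simp only [derivative_mul, derivative_X_sub_C, eval_add, eval_mul, eval_sub, eval_X, eval_C,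
      eval_one] at h
    have hsq : 0 < (b - a) ^ 2 := pow_pos (sub_pos.mpr hab) 2
    by_contra! hn
    nlinarith [mul_nonneg hsq.le hn]
  obtain ⟨c, hac, hcb, h0⟩ := exists_eval_eq_zero_of_mul_neg r hab hr
  exact ⟨c, hac, hcb, by simp [h0]⟩

/-- If the Wronskian of `p` and `q` is positive, then `q` has a root strictly between any two
roots of `p`. -/
theorem exists_eval_eq_zero_of_wronskian_pos (p q : Polynomial ℝ)
    (hW : ∀ x, 0 < (derivative q).eval x * p.eval x - q.eval x * (derivative p).eval x)
    {a b : ℝ} (hab : a < b) (ha : p.eval a = 0) (hb : p.eval b = 0) :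
    ∃ c, a < c ∧ c < b ∧ q.eval c = 0 := by
  by_contra! hn
  have hne : ∀ x ∈ Set.Icc a b, q.eval x ≠ 0 := by
    intro x hx h0
    rcases hx.1.eq_or_lt with rfl | h1
    · simpa [ha, h0] using hW a
    rcases hx.2.eq_or_lt with rfl | h2
    · simpa [hb, h0] using hW x
    exact hn x h1 h2 h0
  obtain ⟨c, hc, h0⟩ := exists_hasDerivAt_eq_zero (f := fun x => p.eval x / q.eval x) hab
    (p.continuous.continuousOn.div q.continuous.continuousOn hne) (by simp [ha, hb])
    (fun x hx => (p.hasDerivAt x).div (q.hasDerivAt x) (hne x (Set.Ioo_subset_Icc_self hx)))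
  rw [div_eq_zero_iff, or_iff_left (pow_ne_zero 2 (hne c (Set.Ioo_subset_Icc_self hc)))] at h0
  linarith [hW c]

/-- for `k ≥ 1` and `γ₁, …, γ_k ∈ (0,1]`: at every real root `ξ` of
`U_k(·,γ)` one has `U'_k(ξ,γ) U_{k+1}(ξ,γ) < 0`; consequently the values of `U_{k+1}(·,γ)`
at consecutive roots of `U_k(·,γ)` alternate in sign, and between any two roots of
`U_k(·,γ)` there is a root of `U_{k+1}(·,γ)` (strict interlacing). -/
theorem stmt13 (k : ℕ) (hk : 1 ≤ k) (γ : ℕ → ℝ)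
    (hγ : ∀ t, 1 ≤ t → t ≤ k → γ t ∈ Set.Ioc (0 : ℝ) 1) :
    (∀ ξ : ℝ, (Upoly γ k).eval ξ = 0 →
      (derivative (Upoly γ k)).eval ξ * (Upoly γ (k + 1)).eval ξ < 0) ∧
    (∀ ξ₁ ξ₂ : ℝ, ξ₁ < ξ₂ → (Upoly γ k).eval ξ₁ = 0 → (Upoly γ k).eval ξ₂ = 0 →
      (∀ η, ξ₁ < η → η < ξ₂ → (Upoly γ k).eval η ≠ 0) →
      (Upoly γ (k + 1)).eval ξ₁ * (Upoly γ (k + 1)).eval ξ₂ < 0) ∧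
    (∀ ξ₁ ξ₂ : ℝ, ξ₁ < ξ₂ → (Upoly γ k).eval ξ₁ = 0 → (Upoly γ k).eval ξ₂ = 0 →
      ∃ η, ξ₁ < η ∧ η < ξ₂ ∧ (Upoly γ (k + 1)).eval η = 0) := by
  have hW := Upoly_wronskian_pos γ k fun t h1 h2 => (hγ t h1 h2).1
  have hneg : ∀ ξ : ℝ, (Upoly γ k).eval ξ = 0 →
      (derivative (Upoly γ k)).eval ξ * (Upoly γ (k + 1)).eval ξ < 0 := by
    intro ξ h0
    have := hW ξ
    rw [h0] at this
    linarith
  refine ⟨hneg, fun a b hab ha hb hn => ?_, fun a b hab ha hb =>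
    exists_eval_eq_zero_of_wronskian_pos _ _ hW hab ha hb⟩
  by_contra! hq
  have hprod := mul_pos_of_neg_of_neg (hneg a ha) (hneg b hb)
  rw [mul_mul_mul_comm] at hprod
  obtain ⟨c, hac, hcb, h0⟩ := exists_eval_eq_zero_of_derivative_mul_pos _ hab ha hb
    (pos_of_mul_pos_left hprod hq)
  exact hn c hac hcb h0
end
end

section
/- Let 1 ≤ j < k, let γ = (γ_1, …, γ_k) be real parameters, and let ξ be a real zero of U_{k+1}(·, γ) with U_k(ξ, γ) ≠ 0. Then the partial derivative of U_{k+1}(x, γ) with respect to the parameter γ_j, evaluated at x = ξ, equals (γ_k·γ_{k−1}···γ_{j+1} / U_k(ξ, γ)) · U_j(ξ, γ) · ((−1)^j·U_j(ξ, γ) − U_{j−1}(ξ, γ)). -/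
noncomputable section

theorem Ufun_add_two (γ : ℕ → ℝ) (k : ℕ) (x : ℝ) :
    Ufun γ (k + 2) x =
      ((-1 : ℝ) ^ (k + 2) * (1 - γ (k + 1)) + x) * Ufun γ (k + 1) x - γ (k + 1) * Ufun γ k x := by
  rw [Ufun]

/-- `U_m` depends only on `γ_1, …, γ_{m-1}`. -/
theorem Ufun_update_of_le (γ : ℕ → ℝ) (j : ℕ) (t x : ℝ) :
    ∀ m, m ≤ j → Ufun (Function.update γ j t) m x = Ufun γ m x
  | 0, _ => by simp [Ufun]
  | 1, _ => by simp [Ufun]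
  | m + 2, hm => by
    rw [Ufun_add_two, Ufun_add_two, Ufun_update_of_le γ j t x (m + 1) (by omega),
      Ufun_update_of_le γ j t x m (by omega), Function.update_of_ne (by omega)]

/-- Consecutive `U_m`, `U_{m+1}` are differentiable in the parameter `γ_j`, and their Wronskian
with respect to `γ_j` is an explicit product. -/
theorem exists_hasDerivAt_Ufun_update (γ : ℕ → ℝ) (x : ℝ) (j m : ℕ) (hj : 1 ≤ j) (hm : j ≤ m) :
    ∃ d d' : ℝ,
      HasDerivAt (fun t => Ufun (Function.update γ j t) m x) d (γ j) ∧
      HasDerivAt (fun t => Ufun (Function.update γ j t) (m + 1) x) d' (γ j) ∧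
      d' * Ufun γ m x - Ufun γ (m + 1) x * d =
        (∏ t ∈ Finset.Icc (j + 1) m, γ t) * Ufun γ j x *
          ((-1 : ℝ) ^ j * Ufun γ j x - Ufun γ (j - 1) x) := by
  induction m, hm using Nat.le_induction with
  | base =>
    obtain ⟨i, rfl⟩ : ∃ i, j = i + 1 := ⟨j - 1, by omega⟩
    refine ⟨0, (-1 : ℝ) ^ (i + 1) * Ufun γ (i + 1) x - Ufun γ i x, ?_, ?_, ?_⟩
    · simpa only [Ufun_update_of_le γ (i + 1) _ x _ le_rfl] using hasDerivAt_const _ _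
    · simp only [Ufun_add_two, Ufun_update_of_le γ (i + 1) _ x _ le_rfl,
        Ufun_update_of_le γ (i + 1) _ x i (by omega), Function.update_self]
      have h := hasDerivAt_id (γ (i + 1))
      refine (((((h.const_sub 1).const_mul ((-1 : ℝ) ^ (i + 2))).add_const x).mul_const
        (Ufun γ (i + 1) x)).sub (h.mul_const (Ufun γ i x))).congr_deriv ?_
      ring
    · simp
      ring
  | succ m hm ih =>
    obtain ⟨d, d', hd, hd', hW⟩ := ih
    refine ⟨d', ((-1 : ℝ) ^ (m + 2) * (1 - γ (m + 1)) + x) * d' - γ (m + 1) * d, hd', ?_, ?_⟩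
    · simp only [Ufun_add_two, Function.update_of_ne (show m + 1 ≠ j by omega)]
      exact (hd'.const_mul _).sub (hd.const_mul _)
    · rw [Finset.prod_Icc_succ_top (by omega), Ufun_add_two]
      linear_combination γ (m + 1) * hW

/-- for `1 ≤ j < k` and a real zero `ξ` of `U_{k+1}(·,γ)` with
`U_k(ξ,γ) ≠ 0`, the partial derivative of `U_{k+1}(x,γ)` with respect to `γ_j` at `x = ξ`
equals `(γ_k γ_{k-1} ⋯ γ_{j+1} / U_k(ξ,γ)) · U_j(ξ,γ) · ((-1)^j U_j(ξ,γ) - U_{j-1}(ξ,γ))`. -/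
theorem stmt14 (k j : ℕ) (hj : 1 ≤ j) (hjk : j < k) (γ : ℕ → ℝ) (ξ : ℝ)
    (hroot : Ufun γ (k + 1) ξ = 0) (hUk : Ufun γ k ξ ≠ 0) :
    deriv (fun t : ℝ => Ufun (Function.update γ j t) (k + 1) ξ) (γ j) =
      ((∏ t ∈ Finset.Icc (j + 1) k, γ t) / Ufun γ k ξ) * Ufun γ j ξ *
        ((-1 : ℝ)^j * Ufun γ j ξ - Ufun γ (j - 1) ξ) := by
  obtain ⟨d, d', -, hd', hW⟩ := exists_hasDerivAt_Ufun_update γ ξ j k hj hjk.le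
  rw [hroot, zero_mul, sub_zero] at hW
  rw [hd'.deriv, div_mul_eq_mul_div, div_mul_eq_mul_div, eq_div_iff hUk, hW]
end
end

section
/- For every integer k ≥ 1, the identity V_{k+1}(x) = (−1)^k·(x − 1)·P_k(−x) holds for all real x. -/
noncomputable section

/-- The identity `V_{k+1}(x) = (-1)^k (x-1) P_k(-x)`, which also holds for `k = 0`. -/
theorem Ufun_zero_one_succ (x : ℝ) : ∀ k : ℕ,
    Ufun (fun t => if t = 1 then (0 : ℝ) else 1) (k + 1) x
      = (-1 : ℝ)^k * (x - 1) * Ufun (fun _ => (1 : ℝ)) k (-x)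
  | 0 => by simp [Ufun]
  | 1 => by simp [Ufun]; ring
  | k + 2 => by
    have h₁ := Ufun_zero_one_succ x (k + 1)
    have h₀ := Ufun_zero_one_succ x k
    rw [Ufun, h₁, h₀, Ufun]
    simp only [Nat.add_eq_right, Nat.add_eq_zero_iff, one_ne_zero, and_false, if_false]
    ring

/-- For every `k ≥ 1`, `V_{k+1}(x) = (-1)^k (x-1) P_k(-x)` for all real `x`,
where `P_m(x) = U_m(x, (1,1,…))` and `V_m(x) = U_m(x, (0,1,1,…))`. -/
theorem stmt15 (k : ℕ) (hk : 1 ≤ k) (x : ℝ) :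
    Ufun (fun t => if t = 1 then (0 : ℝ) else 1) (k + 1) x
      = (-1 : ℝ)^k * (x - 1) * Ufun (fun _ => (1 : ℝ)) k (-x) := by
  exact Ufun_zero_one_succ x k
end
end

section
/- Let k ≥ 1, let γ = (γ_1, …, γ_k) be real parameters, and let 1 ≤ i ≤ k be such that γ_i = 0 and γ_{i+1} = … = γ_k = 1. Then for all real x: if i is even, U_{k+1}(x, γ) = P_{k−i+1}(x)·U_i(x, γ), and if i is odd, U_{k+1}(x, γ) = (−1)^{k−i+1}·P_{k−i+1}(−x)·U_i(x, γ). -/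
noncomputable section

/-- If `γ n = 0` and `γ t = 1` for `n < t ≤ n + m`, then `U_{n+m+1}(·, γ)` is `U_n(·, γ)` times the
solution `p` of the recurrence `p_{j+2} = x p_{j+1} - p_j` with `p_0 = 1`, `p_1 = x + (-1)^{n+1}`. -/
theorem Ufun_eq_mul_of_recurrence (γ : ℕ → ℝ) (x : ℝ) (n : ℕ) (hn : 1 ≤ n) (hγn : γ n = 0)
    (p : ℕ → ℝ) (hp0 : p 0 = 1) (hp1 : p 1 = x + (-1) ^ (n + 1))
    (hp : ∀ j, p (j + 2) = x * p (j + 1) - p j) (m : ℕ)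
    (hγ : ∀ t, n < t → t ≤ n + m → γ t = 1) :
    Ufun γ (n + m + 1) x = p (m + 1) * Ufun γ n x := by
  induction m using Nat.twoStepInduction with
  | zero =>
    obtain ⟨n, rfl⟩ := Nat.exists_eq_add_of_le' hn
    simp only [Nat.zero_add, Ufun, hγn, hp1]
    ring
  | one =>
    obtain ⟨n, rfl⟩ := Nat.exists_eq_add_of_le' hn
    have h := hγ (n + 1 + 1) (by omega) (by omega)
    simp only [Nat.reduceAdd, Ufun, hγn, h, hp 0, hp0, hp1]
    ring
  | more m ih ih' =>
    have h := hγ (n + m + 1 + 1) (by omega) (by omega)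
    have e := ih fun t h₁ h₂ => hγ t h₁ (by omega)
    have e' := ih' fun t h₁ h₂ => hγ t h₁ (by omega)
    rw [← Nat.add_assoc] at e'
    rw [show n + (m + 2) + 1 = n + m + 1 + 2 by omega, Ufun, h, e, e', hp (m + 1)]
    ring

/-- if `γ_i = 0` and `γ_{i+1} = … = γ_k = 1` (with `1 ≤ i ≤ k`), then
for all real `x`: if `i` is even, `U_{k+1}(x,γ) = P_{k-i+1}(x) · U_i(x,γ)`, and if `i` is odd,
`U_{k+1}(x,γ) = (-1)^{k-i+1} · P_{k-i+1}(-x) · U_i(x,γ)`, where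
`P_m(x) = U_m(x, (1,1,…))`. -/
theorem stmt16 (k i : ℕ) (hk : 1 ≤ k) (hi1 : 1 ≤ i) (hik : i ≤ k)
    (γ : ℕ → ℝ) (hγi : γ i = 0) (hγ : ∀ t, i < t → t ≤ k → γ t = 1) (x : ℝ) :
    (Even i → Ufun γ (k + 1) x = Ufun (fun _ => (1 : ℝ)) (k - i + 1) x * Ufun γ i x) ∧
    (Odd i → Ufun γ (k + 1) x
      = (-1 : ℝ)^(k - i + 1) * Ufun (fun _ => (1 : ℝ)) (k - i + 1) (-x) * Ufun γ i x) := by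
  obtain ⟨m, rfl⟩ := Nat.exists_eq_add_of_le hik
  rw [Nat.add_sub_cancel_left]
  constructor <;> intro hi
  · refine Ufun_eq_mul_of_recurrence γ x i hi1 hγi (fun j => Ufun (fun _ => 1) j x) ?_ ?_ ?_ m hγ
    · simp [Ufun]
    · simp [Ufun, pow_succ, hi.neg_one_pow, sub_eq_add_neg]
    · intro j
      simp [Ufun]
  · refine Ufun_eq_mul_of_recurrence γ x i hi1 hγi
      (fun j => (-1) ^ j * Ufun (fun _ => 1) j (-x)) ?_ ?_ ?_ m hγ
    · simp [Ufun]
    · simp only [Ufun, pow_succ, hi.neg_one_pow]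
      ring
    · intro j
      simp only [Ufun]
      ring
end
end

section
/- Let a, c, d > 0 and b, e ≥ 0 be real numbers. Then the cubic polynomial π(λ) = (a − λ)·d + (λ² − (a − b)λ − c − ab)·(λ − e) has exactly three real roots μ_a < μ_b < μ_c, and these satisfy μ_a < λ_− < 0 < μ_b < λ_+ < μ_c, where λ_± = (a − b)/2 ± sqrt((a + b)²/4 + c) are the roots of p(λ) = λ² − (a − b)λ − c − ab. Moreover π(λ_−) > 0, π(0) > 0, and π(λ_+) < 0. -/
noncomputable section

/-- The quadratic `p(λ; a, b, c) = λ² - (a-b)λ - c - ab`. -/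
def pQuad (a b c lam : ℝ) : ℝ := lam^2 - (a - b) * lam - c - a * b

/-- The cubic `π(λ; a, b, c, e, d) = (a - λ)d + p(λ; a,b,c)(λ - e)`. -/
def piCubic (a b c e d lam : ℝ) : ℝ := (a - lam) * d + pQuad a b c lam * (lam - e)

/-- `λ₋(a,b,c) = (a-b)/2 - √((a+b)²/4 + c)`. -/
def lamM (a b c : ℝ) : ℝ := (a - b) / 2 - Real.sqrt ((a + b)^2 / 4 + c)

/-- `λ₊(a,b,c) = (a-b)/2 + √((a+b)²/4 + c)`. -/
def lamP (a b c : ℝ) : ℝ := (a - b) / 2 + Real.sqrt ((a + b)^2 / 4 + c)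

/-- A real monic cubic is positive somewhere beyond any given point. -/
theorem exists_ge_monic_cubic_pos (A B C t : ℝ) :
    ∃ M, t ≤ M ∧ 0 < M ^ 3 + A * M ^ 2 + B * M + C := by
  refine ⟨1 + |A| + |B| + |C| + |t|, ?_, ?_⟩
  · linarith [le_abs_self t, abs_nonneg A, abs_nonneg B, abs_nonneg C]
  · set M := 1 + |A| + |B| + |C| + |t| with hM
    have hA := abs_nonneg A
    have hB := abs_nonneg B
    have hC := abs_nonneg C
    have ht := abs_nonneg t
    have hM1 : 1 ≤ M := by linarith
    have hM2 : M ≤ M ^ 2 := by nlinarith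
    have h1 : (1 + |B| + |C|) * M ^ 2 ≤ (M + A) * M ^ 2 :=
      mul_le_mul_of_nonneg_right (by linarith [neg_abs_le A]) (sq_nonneg M)
    have h2 : -(|B| * M) ≤ B * M := by nlinarith [neg_abs_le B]
    have h3 : |B| * M ≤ |B| * M ^ 2 := mul_le_mul_of_nonneg_left hM2 hB
    have h4 : |C| * 1 ≤ |C| * M ^ 2 := mul_le_mul_of_nonneg_left (by linarith) hC
    nlinarith [neg_abs_le C]

/-- A real monic cubic is negative somewhere before any given point. -/
theorem exists_le_monic_cubic_neg (A B C t : ℝ) :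
    ∃ M, M ≤ t ∧ M ^ 3 + A * M ^ 2 + B * M + C < 0 := by
  obtain ⟨M, hM, h⟩ := exists_ge_monic_cubic_pos (-A) B (-C) (-t)
  exact ⟨-M, by linarith, by nlinarith⟩

/-- A monic cubic with three distinct roots has no other root. -/
theorem eq_of_monic_cubic_roots {A B C u v w x : ℝ} (huv : u ≠ v) (huw : u ≠ w) (hvw : v ≠ w)
    (hu : u ^ 3 + A * u ^ 2 + B * u + C = 0) (hv : v ^ 3 + A * v ^ 2 + B * v + C = 0)
    (hw : w ^ 3 + A * w ^ 2 + B * w + C = 0) (hx : x ^ 3 + A * x ^ 2 + B * x + C = 0) :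
    x = u ∨ x = v ∨ x = w := by
  have quad : ∀ y, y ≠ u → y ^ 3 + A * y ^ 2 + B * y + C = 0 →
      y ^ 2 + y * u + u ^ 2 + A * (y + u) + B = 0 := fun y hy h =>
    mul_left_cancel₀ (sub_ne_zero.2 hy) (by linear_combination h - hu)
  have lin : ∀ y, y ≠ u → y ≠ v → y ^ 3 + A * y ^ 2 + B * y + C = 0 →
      y + u + v + A = 0 := fun y hyu hyv h =>
    mul_left_cancel₀ (sub_ne_zero.2 hyv)
      (by linear_combination quad y hyu h - quad v huv.symm hv)
  by_cases hxu : x = u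
  · exact Or.inl hxu
  by_cases hxv : x = v
  · exact Or.inr (Or.inl hxv)
  exact Or.inr (Or.inr (by linarith [lin x hxu hxv hx, lin w huw.symm hvw.symm hw]))

theorem piCubic_eq_monic (a b c e d x : ℝ) :
    piCubic a b c e d x =
      x ^ 3 + (-(a - b) - e) * x ^ 2 + ((a - b) * e - c - a * b - d) * x
        + (a * d + (c + a * b) * e) := by
  unfold piCubic pQuad
  ring

theorem continuous_piCubic (a b c e d : ℝ) : Continuous (piCubic a b c e d) := by
  unfold piCubic pQuad
  fun_prop

theorem pQuad_lamM {a b c : ℝ} (hc : 0 ≤ c) : pQuad a b c (lamM a b c) = 0 := by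
  have h := Real.sq_sqrt (show 0 ≤ (a + b) ^ 2 / 4 + c by positivity)
  unfold pQuad lamM
  linear_combination h

theorem pQuad_lamP {a b c : ℝ} (hc : 0 ≤ c) : pQuad a b c (lamP a b c) = 0 := by
  have h := Real.sq_sqrt (show 0 ≤ (a + b) ^ 2 / 4 + c by positivity)
  unfold pQuad lamP
  linear_combination h

theorem half_add_lt_sqrt {a b c : ℝ} (hc : 0 < c) :
    (a + b) / 2 < √((a + b) ^ 2 / 4 + c) :=
  Real.lt_sqrt_of_sq_lt (by linarith [show ((a + b) / 2) ^ 2 = (a + b) ^ 2 / 4 by ring])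

theorem lamM_neg {a b c : ℝ} (hb : 0 ≤ b) (hc : 0 < c) : lamM a b c < 0 := by
  have h := half_add_lt_sqrt (a := a) (b := b) hc
  unfold lamM
  linarith

theorem lt_lamP {a b c : ℝ} (hc : 0 < c) : a < lamP a b c := by
  have h := half_add_lt_sqrt (a := a) (b := b) hc
  unfold lamP
  linarith

/-- for `a, c, d > 0` and `b, e ≥ 0`, the cubic `π` has exactly three real
roots `μ_a < μ_b < μ_c` with `μ_a < λ₋ < 0 < μ_b < λ₊ < μ_c`; moreover
`π(λ₋) > 0`, `π(0) > 0`, and `π(λ₊) < 0`. -/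
theorem stmt18 (a b c e d : ℝ) (ha : 0 < a) (hb : 0 ≤ b) (hc : 0 < c) (he : 0 ≤ e)
    (hd : 0 < d) :
    ∃ μa μb μc : ℝ,
      piCubic a b c e d μa = 0 ∧ piCubic a b c e d μb = 0 ∧ piCubic a b c e d μc = 0 ∧
      (∀ x : ℝ, piCubic a b c e d x = 0 → x = μa ∨ x = μb ∨ x = μc) ∧
      μa < lamM a b c ∧ lamM a b c < 0 ∧ 0 < μb ∧ μb < lamP a b c ∧ lamP a b c < μc ∧
      0 < piCubic a b c e d (lamM a b c) ∧ 0 < piCubic a b c e d 0 ∧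
      piCubic a b c e d (lamP a b c) < 0 := by
  have hM := lamM_neg (a := a) hb hc
  have hP := lt_lamP (a := a) (b := b) hc
  have hπM : 0 < piCubic a b c e d (lamM a b c) := by
    rw [piCubic, pQuad_lamM hc.le, zero_mul, add_zero]
    exact mul_pos (by linarith) hd
  have hπ0 : 0 < piCubic a b c e d 0 := by
    rw [piCubic_eq_monic]
    have := mul_pos ha hd
    have : 0 ≤ (c + a * b) * e := by positivity
    linarith
  have hπP : piCubic a b c e d (lamP a b c) < 0 := by
    rw [piCubic, pQuad_lamP hc.le, zero_mul, add_zero]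
    exact mul_neg_of_neg_of_pos (by linarith) hd
  have cont := continuous_piCubic a b c e d
  obtain ⟨l, hl, hπl⟩ := exists_le_monic_cubic_neg (-(a - b) - e)
    ((a - b) * e - c - a * b - d) (a * d + (c + a * b) * e) (lamM a b c)
  obtain ⟨r, hr, hπr⟩ := exists_ge_monic_cubic_pos (-(a - b) - e)
    ((a - b) * e - c - a * b - d) (a * d + (c + a * b) * e) (lamP a b c)
  rw [← piCubic_eq_monic] at hπl hπr
  obtain ⟨u, hu, hu0⟩ := intermediate_value_Ioo hl cont.continuousOn ⟨hπl, hπM⟩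
  obtain ⟨v, hv, hv0⟩ :=
    intermediate_value_Ioo' (ha.trans hP).le cont.continuousOn ⟨hπP, hπ0⟩
  obtain ⟨w, hw, hw0⟩ := intermediate_value_Ioo hr cont.continuousOn ⟨hπP, hπr⟩
  have huv : u < v := hu.2.trans (hM.trans hv.1)
  have hvw : v < w := hv.2.trans hw.1
  refine ⟨u, v, w, hu0, hv0, hw0, fun x hx => ?_, hu.2, hM, hv.1, hv.2, hw.1, hπM, hπ0, hπP⟩
  rw [piCubic_eq_monic] at hu0 hv0 hw0 hx
  exact eq_of_monic_cubic_roots huv.ne (huv.trans hvw).ne hvw.ne hu0 hv0 hw0 hx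
end
end

section
/- Let 0 < a₁ ≤ a₂, 0 ≤ b₁ ≤ b₂, 0 < c₁ ≤ c₂, 0 ≤ e₁ ≤ e₂, 0 < d₁ ≤ d₂ be real numbers, and let a ∈ [a₁, a₂], b ∈ [b₁, b₂], c ∈ [c₁, c₂], e ∈ [e₁, e₂], d ∈ [d₁, d₂]. Then every real root ξ of the cubic π(·; a, b, c, e, d) satisfies ξ ∈ [μ_a(a₁, b₂, c₂, e₁, d₂), μ_a(a₂, b₁, c₁, e₂, d₁)] ∪ [min{ a₁, μ_b(a₁, b₂, c₂, e₁, d₁) }, μ_c(a₂, b₁, c₂, e₂, d₂)]. -/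
noncomputable section

/-- `piCubic a b c e d x = (x - a) (x - e) * secular a b c e d x` away from the poles. -/
def secular (a b c e d x : ℝ) : ℝ := x + b + c / (a - x) + d / (e - x)

lemma piCubic_eq_mul_secular {a b c e d x : ℝ} (ha : a - x ≠ 0) (he : e - x ≠ 0) :
    piCubic a b c e d x = (a - x) * (e - x) * secular a b c e d x := by
  unfold piCubic pQuad secular
  field_simp
  ring

/-- Increasing enumeration of the roots of the cubic. -/
structure IsRootTriple (a b c e d p q r : ℝ) : Prop where
  lt_left : p < q
  lt_right : q < r
  factor : ∀ x, piCubic a b c e d x = (x - p) * (x - q) * (x - r)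

lemma IsRootTriple.of_roots {a b c e d p q r : ℝ} (hpq : p < q) (hqr : q < r)
    (hp : piCubic a b c e d p = 0) (hq : piCubic a b c e d q = 0)
    (hr : piCubic a b c e d r = 0) : IsRootTriple a b c e d p q r := by
  refine ⟨hpq, hqr, fun x => ?_⟩
  unfold piCubic pQuad at *
  have h₁ : p ^ 2 + p * q + q ^ 2 + (b - a - e) * (p + q) + (a * e - b * e - c - a * b - d) = 0 := by
    apply mul_left_cancel₀ (sub_ne_zero.2 hpq.ne)
    linear_combination hp - hq
  have h₂ : q ^ 2 + q * r + r ^ 2 + (b - a - e) * (q + r) + (a * e - b * e - c - a * b - d) = 0 := by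
    apply mul_left_cancel₀ (sub_ne_zero.2 hqr.ne)
    linear_combination hq - hr
  have h₃ : p + q + r + (b - a - e) = 0 := by
    apply mul_left_cancel₀ (sub_ne_zero.2 (hpq.trans hqr).ne)
    linear_combination h₁ - h₂
  linear_combination hp + (x - p) * h₁ + (x - p) * (x - q) * h₃

namespace IsRootTriple

variable {a b c e d p q r : ℝ}

lemma of_nonneg (h : IsRootTriple a b c e d p q r) {x : ℝ} (hx : 0 ≤ piCubic a b c e d x) :
    (p ≤ x ∧ x ≤ q) ∨ r ≤ x := by
  have h₁ := h.lt_left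
  have h₂ := h.lt_right
  rw [h.factor] at hx
  by_contra! hcon
  rcases lt_or_ge x p with hp | hp
  · nlinarith [mul_pos (mul_pos (sub_pos.2 hp) (sub_pos.2 (hp.trans h₁)))
      (sub_pos.2 (hp.trans (h₁.trans h₂)))]
  · have hq := hcon.1 hp
    nlinarith [mul_pos (mul_pos (sub_pos.2 (h₁.trans hq)) (sub_pos.2 hq)) (sub_pos.2 hcon.2)]

lemma of_nonpos (h : IsRootTriple a b c e d p q r) {x : ℝ} (hx : piCubic a b c e d x ≤ 0) :
    x ≤ p ∨ (q ≤ x ∧ x ≤ r) := by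
  have h₁ := h.lt_left
  have h₂ := h.lt_right
  rw [h.factor] at hx
  by_contra! hcon
  rcases lt_or_ge x q with hq | hq
  · nlinarith [mul_pos (mul_pos (sub_pos.2 hcon.1) (sub_pos.2 hq)) (sub_pos.2 (hq.trans h₂))]
  · have hr := hcon.2 hq
    nlinarith [mul_pos (mul_pos (sub_pos.2 hcon.1) (sub_pos.2 (h₂.trans hr))) (sub_pos.2 hr)]

lemma ne_of_ne_zero (h : IsRootTriple a b c e d p q r) {x : ℝ} (hx : piCubic a b c e d x ≠ 0) :
    x ≠ p ∧ x ≠ q ∧ x ≠ r := by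
  rw [h.factor] at hx
  refine ⟨?_, ?_, ?_⟩ <;> rintro rfl <;> simp at hx

/-- The poles of the secular function interlace the roots. -/
lemma interlace (h : IsRootTriple a b c e d p q r) (hc : 0 < c) (hd : 0 < d) :
    p < min a e ∧ min a e ≤ q ∧ q ≤ max a e ∧ max a e < r := by
  have h₁ := h.lt_left
  have h₂ := h.lt_right
  have ha : piCubic a b c e d a = c * (e - a) := by unfold piCubic pQuad; ring
  have he : piCubic a b c e d e = d * (a - e) := by unfold piCubic pQuad; ring
  rcases lt_trichotomy a e with hae | rfl | hae
  · have ha' : 0 < piCubic a b c e d a := ha ▸ mul_pos hc (sub_pos.2 hae)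
    have he' : piCubic a b c e d e < 0 := he ▸ mul_neg_of_pos_of_neg hd (sub_neg.2 hae)
    obtain ⟨n₁, n₂, n₃⟩ := h.ne_of_ne_zero ha'.ne'
    obtain ⟨m₁, m₂, m₃⟩ := h.ne_of_ne_zero he'.ne
    rw [min_eq_left hae.le, max_eq_right hae.le]
    have k₁ := h.of_nonneg ha'.le
    have k₂ := h.of_nonpos he'.le
    grind
  · rw [min_self, max_self]
    have hquad : ∀ x, piCubic a b c a d x = (x - a) * ((x + b) * (x - a) - (c + d)) := by
      intro x; unfold piCubic pQuad; ring
    have hderiv : (a - p) * (a - q) + (a - p) * (a - r) + (a - q) * (a - r) = -(c + d) := by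
      have f₀ := h.factor a
      have f₁ := h.factor (a + 1)
      have f₂ := h.factor (a - 1)
      have f₃ := h.factor (a + 2)
      rw [hquad] at f₀ f₁ f₂ f₃
      linarith
    have hroot : (a - p) * (a - q) * (a - r) = 0 := by
      rw [← h.factor, hquad]; ring
    rcases mul_eq_zero.1 hroot with hroot | hroot
    · rcases mul_eq_zero.1 hroot with hroot | hroot
      · obtain rfl := sub_eq_zero.1 hroot
        nlinarith [mul_pos (sub_pos.2 h₁) (sub_pos.2 (h₁.trans h₂))]
      · obtain rfl := sub_eq_zero.1 hroot
        exact ⟨h₁, le_rfl, le_rfl, h₂⟩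
    · obtain rfl := sub_eq_zero.1 hroot
      nlinarith [mul_pos (sub_pos.2 h₂) (sub_pos.2 (h₁.trans h₂))]
  · have ha' : piCubic a b c e d a < 0 := ha ▸ mul_neg_of_pos_of_neg hc (sub_neg.2 hae)
    have he' : 0 < piCubic a b c e d e := he ▸ mul_pos hd (sub_pos.2 hae)
    obtain ⟨n₁, n₂, n₃⟩ := h.ne_of_ne_zero ha'.ne
    obtain ⟨m₁, m₂, m₃⟩ := h.ne_of_ne_zero he'.ne'
    rw [min_eq_right hae.le, max_eq_left hae.le]
    have k₁ := h.of_nonpos ha'.le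
    have k₂ := h.of_nonneg he'.le
    grind

lemma eval_left (h : IsRootTriple a b c e d p q r) : piCubic a b c e d p = 0 := by
  rw [h.factor]; ring

lemma eval_middle (h : IsRootTriple a b c e d p q r) : piCubic a b c e d q = 0 := by
  rw [h.factor]; ring

lemma eval_right (h : IsRootTriple a b c e d p q r) : piCubic a b c e d r = 0 := by
  rw [h.factor]; ring

variable {a' b' c' e' d' p' q' r' : ℝ}

lemma left_le_left (h : IsRootTriple a b c e d p q r) (h' : IsRootTriple a' b' c' e' d' p' q' r')
    (hc' : 0 < c') (hd' : 0 < d') (ha : a ≤ a') (hb : b' ≤ b) (hc : c' ≤ c) (he : e ≤ e')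
    (hd : d' ≤ d) : p ≤ p' := by
  obtain ⟨hp, -, -, -⟩ := h.interlace (hc'.trans_le hc) (hd'.trans_le hd)
  obtain ⟨hpa, hpe⟩ := lt_min_iff.1 hp
  obtain ⟨-, hq', -, -⟩ := h'.interlace hc' hd'
  have ha₀ : 0 < a - p := sub_pos.2 hpa
  have he₀ : 0 < e - p := sub_pos.2 hpe
  have ha₁ : 0 < a' - p := by linarith
  have he₁ : 0 < e' - p := by linarith
  have h₀ := h.eval_left
  rw [piCubic_eq_mul_secular ha₀.ne' he₀.ne'] at h₀
  have hs : secular a b c e d p = 0 :=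
    (mul_eq_zero.1 h₀).resolve_left (mul_pos ha₀ he₀).ne'
  have hle : secular a' b' c' e' d' p ≤ secular a b c e d p := by
    have k₁ : c' / (a' - p) ≤ c / (a - p) :=
      div_le_div₀ (hc'.le.trans hc) hc ha₀ (by linarith)
    have k₂ : d' / (e' - p) ≤ d / (e - p) :=
      div_le_div₀ (hd'.le.trans hd) hd he₀ (by linarith)
    unfold secular; linarith
  rcases h'.of_nonpos (x := p) (by
    rw [piCubic_eq_mul_secular ha₁.ne' he₁.ne']
    exact mul_nonpos_of_nonneg_of_nonpos (mul_pos ha₁ he₁).le (hle.trans hs.le)) with h₁ | h₁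
  · exact h₁
  · have : p < min a' e' := lt_min (by linarith) (by linarith)
    linarith [h₁.1]

lemma right_le_right (h : IsRootTriple a b c e d p q r)
    (h' : IsRootTriple a' b' c' e' d' p' q' r')
    (hc₀ : 0 < c) (hd₀ : 0 < d) (ha : a ≤ a') (hb : b' ≤ b) (hc : c ≤ c') (he : e ≤ e')
    (hd : d ≤ d') : r ≤ r' := by
  obtain ⟨-, -, -, hr⟩ := h'.interlace (hc₀.trans_le hc) (hd₀.trans_le hd)
  obtain ⟨hra, hre⟩ := max_lt_iff.1 hr
  obtain ⟨-, -, hq, -⟩ := h.interlace hc₀ hd₀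
  have ha₀ : 0 < r' - a' := sub_pos.2 hra
  have he₀ : 0 < r' - e' := sub_pos.2 hre
  have ha₁ : 0 < r' - a := by linarith
  have he₁ : 0 < r' - e := by linarith
  have hneg : ∀ x y z : ℝ, z / (x - y) = -(z / (y - x)) := fun x y z => by
    rw [← neg_sub y x, div_neg]
  have h₀ := h'.eval_right
  rw [piCubic_eq_mul_secular (by linarith) (by linarith)] at h₀
  have hs : secular a' b' c' e' d' r' = 0 :=
    (mul_eq_zero.1 h₀).resolve_left (by nlinarith [mul_pos ha₀ he₀])
  have hle : secular a' b' c' e' d' r' ≤ secular a b c e d r' := by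
    have k₁ : c / (r' - a) ≤ c' / (r' - a') :=
      div_le_div₀ (hc₀.le.trans hc) hc ha₀ (by linarith)
    have k₂ : d / (r' - e) ≤ d' / (r' - e') :=
      div_le_div₀ (hd₀.le.trans hd) hd he₀ (by linarith)
    unfold secular
    rw [hneg a, hneg e, hneg a', hneg e']
    linarith
  rcases h.of_nonneg (x := r') (by
    rw [piCubic_eq_mul_secular (by linarith) (by linarith)]
    exact mul_nonneg (by nlinarith [mul_pos ha₁ he₁]) (hs.ge.trans hle)) with h₁ | h₁
  · have : max a e < r' := max_lt (by linarith) (by linarith)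
    linarith [h₁.2]
  · exact h₁

lemma min_le_middle (h : IsRootTriple a b c e d p q r)
    (h' : IsRootTriple a' b' c' e' d' p' q' r')
    (hc₀ : 0 < c') (hd₀ : 0 < d) (ha : a ≤ a') (hb : b' ≤ b) (hc : c' ≤ c) (he : e ≤ e')
    (hd : d ≤ d') : min a q ≤ q' := by
  by_contra! hcon
  obtain ⟨hqa, hqq⟩ := lt_min_iff.1 hcon
  obtain ⟨-, hq', -, -⟩ := h'.interlace hc₀ (hd₀.trans_le hd)
  have hq'e : e' ≤ q' := (min_le_iff.1 hq').resolve_left (by linarith)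
  have hne : q' ≠ e' := by
    rintro rfl
    have h₀ := h'.eval_middle
    have : piCubic a' b' c' q' d' q' = d' * (a' - q') := by unfold piCubic pQuad; ring
    rw [this] at h₀
    nlinarith [mul_pos (hd₀.trans_le hd) (show 0 < a' - q' by linarith)]
  have he₀ : 0 < q' - e' := sub_pos.2 (lt_of_le_of_ne hq'e hne.symm)
  have he₁ : 0 < q' - e := by linarith
  have ha₀ : 0 < a - q' := sub_pos.2 hqa
  have ha₁ : 0 < a' - q' := by linarith
  have hneg : ∀ x y z : ℝ, z / (x - y) = -(z / (y - x)) := fun x y z => by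
    rw [← neg_sub y x, div_neg]
  have h₀ := h'.eval_middle
  rw [piCubic_eq_mul_secular (by linarith) (by linarith)] at h₀
  have hs : secular a' b' c' e' d' q' = 0 :=
    (mul_eq_zero.1 h₀).resolve_left (by nlinarith [mul_pos ha₁ he₀])
  have hle : secular a' b' c' e' d' q' ≤ secular a b c e d q' := by
    have k₁ : c' / (a' - q') ≤ c / (a - q') :=
      div_le_div₀ (hc₀.le.trans hc) hc ha₀ (by linarith)
    have k₂ : d / (q' - e) ≤ d' / (q' - e') :=
      div_le_div₀ (hd₀.le.trans hd) hd he₀ (by linarith)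
    unfold secular
    rw [hneg e, hneg e']
    linarith
  obtain ⟨hp, -, -, -⟩ := h.interlace (hc₀.trans_le hc) hd₀
  have hpe : p < e := (lt_min_iff.1 hp).2
  rcases h.of_nonpos (x := q') (by
    rw [piCubic_eq_mul_secular (by linarith) (by linarith)]
    exact mul_nonpos_of_nonpos_of_nonneg (by nlinarith [mul_pos ha₀ he₁]) (hs.ge.trans hle))
    with h₁ | h₁
  · linarith
  · linarith [h₁.1]

end IsRootTriple

/-- with `μ_a(a,b,c,e,d) < μ_b(a,b,c,e,d) < μ_c(a,b,c,e,d)` denoting the three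
real roots of the cubic `π(·; a,b,c,e,d)` (for admissible parameters `a, c, d > 0`,
`b, e ≥ 0`), every real root `ξ` of `π(·; a,b,c,e,d)` with `a ∈ [a₁,a₂]`, `b ∈ [b₁,b₂]`,
`c ∈ [c₁,c₂]`, `e ∈ [e₁,e₂]`, `d ∈ [d₁,d₂]` lies in
`[μ_a(a₁,b₂,c₂,e₁,d₂), μ_a(a₂,b₁,c₁,e₂,d₁)] ∪ [min{a₁, μ_b(a₁,b₂,c₂,e₁,d₁)}, μ_c(a₂,b₁,c₂,e₂,d₂)]`. -/
theorem stmt19 (μa μb μc : ℝ → ℝ → ℝ → ℝ → ℝ → ℝ)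
    (hμ : ∀ a b c e d : ℝ, 0 < a → 0 ≤ b → 0 < c → 0 ≤ e → 0 < d →
      μa a b c e d < μb a b c e d ∧ μb a b c e d < μc a b c e d ∧
      piCubic a b c e d (μa a b c e d) = 0 ∧ piCubic a b c e d (μb a b c e d) = 0 ∧
      piCubic a b c e d (μc a b c e d) = 0 ∧
      (∀ x : ℝ, piCubic a b c e d x = 0 →
        x = μa a b c e d ∨ x = μb a b c e d ∨ x = μc a b c e d))
    (a₁ a₂ b₁ b₂ c₁ c₂ e₁ e₂ d₁ d₂ a b c e d : ℝ)
    (ha₁ : 0 < a₁) (ha₁₂ : a₁ ≤ a₂) (hb₁ : 0 ≤ b₁) (hb₁₂ : b₁ ≤ b₂)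
    (hc₁ : 0 < c₁) (hc₁₂ : c₁ ≤ c₂) (he₁ : 0 ≤ e₁) (he₁₂ : e₁ ≤ e₂)
    (hd₁ : 0 < d₁) (hd₁₂ : d₁ ≤ d₂)
    (haI : a ∈ Set.Icc a₁ a₂) (hbI : b ∈ Set.Icc b₁ b₂) (hcI : c ∈ Set.Icc c₁ c₂)
    (heI : e ∈ Set.Icc e₁ e₂) (hdI : d ∈ Set.Icc d₁ d₂)
    (ξ : ℝ) (hξ : piCubic a b c e d ξ = 0) :
    (μa a₁ b₂ c₂ e₁ d₂ ≤ ξ ∧ ξ ≤ μa a₂ b₁ c₁ e₂ d₁) ∨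
    (min a₁ (μb a₁ b₂ c₂ e₁ d₁) ≤ ξ ∧ ξ ≤ μc a₂ b₁ c₂ e₂ d₂) := by
  obtain ⟨ha, ha'⟩ := haI
  obtain ⟨hb, hb'⟩ := hbI
  obtain ⟨hc, hc'⟩ := hcI
  obtain ⟨he, he'⟩ := heI
  obtain ⟨hd, hd'⟩ := hdI
  have triple : ∀ a b c e d : ℝ, 0 < a → 0 ≤ b → 0 < c → 0 ≤ e → 0 < d →
      IsRootTriple a b c e d (μa a b c e d) (μb a b c e d) (μc a b c e d) := by
    intro a b c e d ha hb hc he hd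
    obtain ⟨h₁, h₂, h₃, h₄, h₅, -⟩ := hμ a b c e d ha hb hc he hd
    exact .of_roots h₁ h₂ h₃ h₄ h₅
  have a_pos : 0 < a := by linarith
  have b_nonneg : 0 ≤ b := by linarith
  have c_pos : 0 < c := by linarith
  have e_nonneg : 0 ≤ e := by linarith
  have d_pos : 0 < d := by linarith
  have t := triple a b c e d a_pos b_nonneg c_pos e_nonneg d_pos
  have hmiddle := (triple a₁ b₂ c₂ e₁ d₁ ha₁ (by linarith) (by linarith) he₁ hd₁).min_le_middle t
    c_pos hd₁ ha hb' hc' he hd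
  have hright := t.right_le_right
    (triple a₂ b₁ c₂ e₂ d₂ (by linarith) hb₁ (by linarith) (by linarith) (by linarith))
    c_pos d_pos ha' hb hc' he' hd'
  have hqr := t.lt_right
  obtain ⟨-, -, -, -, -, hall⟩ := hμ a b c e d a_pos b_nonneg c_pos e_nonneg d_pos
  rcases hall ξ hξ with rfl | rfl | rfl
  · left
    exact ⟨(triple a₁ b₂ c₂ e₁ d₂ ha₁ (by linarith) (by linarith) he₁ (by linarith)).left_le_left t
        c_pos d_pos ha hb' hc' he hd',
      t.left_le_left (triple a₂ b₁ c₁ e₂ d₁ (by linarith) hb₁ hc₁ (by linarith) hd₁)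
        hc₁ hd₁ ha' hb hc he' hd⟩
  · right
    exact ⟨hmiddle, hqr.le.trans hright⟩
  · right
    exact ⟨hmiddle.trans hqr.le, hright⟩
end
end
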